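/- arXiv:2310.00695 — 2 statements merged into one kernel-verified Lean document; each statement's English description precedes it below -/
import Mathlib

section
/- For α ∈ (1,2], the function λ ↦ (λ^{α-1} - 1)/(λ^α - 1) (extended by (α-1)/α at λ = 1) is the Laplace transform of a probability density on (0,∞); in particular its value at 0 is 1 and it is completely monotone. -/
open Real Set

/-- A function is completely monotone on `(0,∞)` if it is smooth there and its `n`-th
derivative has sign `(-1)^n`. -/
def CompletelyMonotoneOn (f : ℝ → ℝ) : Prop :=
  ContDiffOn ℝ (⊤ : ℕ∞) f (Ioi 0) ∧
    ∀ (n : ℕ) (x : ℝ), 0 < x → 0 ≤ (-1 : ℝ) ^ n * iteratedDerivWithin n f (Ioi 0) x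


open MeasureTheory Filter Topology

lemma edge_tendsto (H : ℂ → ℂ) (hH : ∀ z : ℂ, |z.im| ≤ π → DifferentiableAt ℂ H z)
    (a : ℂ) (l : Filter ℝ) [l.IsCountablyGenerated]
    (ha : Tendsto H (comap Complex.re l) (𝓝 a)) :
    Tendsto (fun R : ℝ => ∫ y in (-π)..π, H ((R : ℂ) + (y : ℂ) * Complex.I)) l
      (𝓝 (2 * π * a)) := by
  have h2 : (2 * π * a : ℂ) = ∫ y in (-π)..π, a := by
    rw [intervalIntegral.integral_const]
    simp only [Complex.real_smul]
    push_cast; ring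
  rw [h2]
  have hev : ∀ᶠ R in l, ∀ z : ℂ, z.re = R → ‖H z‖ ≤ ‖a‖ + 1 := by
    have h3 : ∀ᶠ z in comap Complex.re l, ‖H z‖ ≤ ‖a‖ + 1 :=
      ha.norm.eventually (eventually_le_nhds (by linarith))
    exact eventually_comap.1 h3
  refine intervalIntegral.tendsto_integral_filter_of_dominated_convergence
    (fun _ => ‖a‖ + 1) ?_ ?_ (by simp) ?_
  · refine Eventually.of_forall fun R => ?_
    refine ContinuousOn.aestronglyMeasurable ?_ measurableSet_uIoc
    intro y hy
    apply ContinuousAt.continuousWithinAt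
    apply ContinuousAt.comp (g := H) (f := fun y : ℝ => (R : ℂ) + (y : ℂ) * Complex.I)
    · refine (hH _ ?_).continuousAt
      rw [uIoc_of_le (by linarith [pi_pos])] at hy
      simpa using abs_le.2 ⟨hy.1.le, hy.2⟩
    · fun_prop
  · filter_upwards [hev] with R hR
    refine ae_of_all _ fun y _ => hR _ (by simp)
  · refine ae_of_all _ fun y _ => ha.comp ?_
    rw [tendsto_comap_iff]
    refine tendsto_id.congr fun x => by simp

lemma strip_integral (H : ℂ → ℂ) (hH : ∀ z : ℂ, |z.im| ≤ π → DifferentiableAt ℂ H z)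
    (a b : ℂ) (ha : Tendsto H (comap Complex.re atTop) (𝓝 a))
    (hb : Tendsto H (comap Complex.re atBot) (𝓝 b)) (J : ℝ → ℝ) (hJc : Continuous J)
    (hJ0 : ∀ x, 0 ≤ J x)
    (hJ : ∀ x : ℝ, H ((x : ℂ) + ((-π : ℝ) : ℂ) * Complex.I) - H ((x : ℂ) + (π : ℂ) * Complex.I)
      = 2 * π * Complex.I * (J x : ℂ)) :
    Integrable J ∧ ((∫ x, J x : ℝ) : ℂ) = b - a := by
  have key : ∀ R : ℝ, ((∫ x in (-R)..R, J x : ℝ) : ℂ) =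
      (2 * π : ℂ)⁻¹ * ((∫ y in (-π)..π, H (((-R : ℝ) : ℂ) + (y : ℂ) * Complex.I)) -
        (∫ y in (-π)..π, H ((R : ℂ) + (y : ℂ) * Complex.I))) := by
    intro R
    have := Complex.integral_boundary_rect_eq_zero_of_differentiableOn H
      (⟨-R, -π⟩ : ℂ) (⟨R, π⟩ : ℂ) (by
        intro z hz
        apply (hH z _).differentiableWithinAt
        have := hz.2
        simp only [mem_preimage, uIcc_of_le (show -π ≤ π by linarith [pi_pos])] at this
        exact abs_le.2 this)
    simp only [smul_eq_mul] at this
    have hc : ∀ c : ℝ, |c| ≤ π → Continuous fun x : ℝ => H ((x : ℂ) + (c : ℂ) * Complex.I) := by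
      intro c hc
      rw [continuous_iff_continuousAt]
      intro x
      apply ContinuousAt.comp (g := H) (f := fun x : ℝ => (x : ℂ) + (c : ℂ) * Complex.I)
      · exact (hH _ (by simpa using hc)).continuousAt
      · fun_prop
    rw [← intervalIntegral.integral_sub
      ((hc (-π) (by simp [abs_of_pos pi_pos])).intervalIntegrable _ _)
      ((hc π (by simp [abs_of_pos pi_pos])).intervalIntegrable _ _)] at this
    simp only [hJ] at this
    rw [intervalIntegral.integral_const_mul, intervalIntegral.integral_ofReal] at this
    have hpi : (π : ℂ) ≠ 0 := by exact_mod_cast pi_ne_zero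
    have h3 : Complex.I * (2 * π * ((∫ x in (-R)..R, J x : ℝ) : ℂ) - ((∫ y in (-π)..π, H (((-R : ℝ) : ℂ) + (y : ℂ) * Complex.I)) -
        (∫ y in (-π)..π, H ((R : ℂ) + (y : ℂ) * Complex.I)))) = 0 := by
      rw [← this]; ring
    have h4 := (mul_eq_zero.1 h3).resolve_left Complex.I_ne_zero
    rw [← sub_eq_zero.1 h4]
    field_simp
  have lim : Tendsto (fun R : ℝ => ((∫ x in (-R)..R, J x : ℝ) : ℂ)) atTop (𝓝 (b - a)) := by
    simp_rw [key]
    have h1 := edge_tendsto H hH a _ ha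
    have h2 := (edge_tendsto H hH b _ hb).comp tendsto_neg_atTop_atBot
    have h3 := (h2.sub h1).const_mul ((2 * π : ℂ)⁻¹)
    have hpi : (π : ℂ) ≠ 0 := by exact_mod_cast pi_ne_zero
    have h5 : (2 * π : ℂ)⁻¹ * (2 * π * b - 2 * π * a) = b - a := by field_simp
    rw [h5] at h3
    exact h3
  have limR : Tendsto (fun R : ℝ => ∫ x in (-R)..R, J x) atTop (𝓝 (b - a).re) := by
    exact (Complex.continuous_re.tendsto _).comp lim
  have hInt : Integrable J := by
    refine integrable_of_intervalIntegral_norm_tendsto (a := fun R => -R) (b := fun R : ℝ => R)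
      (l := atTop) (b - a).re
      (fun i => (hJc.integrableOn_Icc).mono_set Ioc_subset_Icc_self)
      tendsto_neg_atTop_atBot tendsto_id ?_
    simpa [abs_of_nonneg (hJ0 _)] using limR
  refine ⟨hInt, ?_⟩
  have l2 := intervalIntegral_tendsto_integral hInt tendsto_neg_atTop_atBot tendsto_id
  exact tendsto_nhds_unique ((Complex.continuous_ofReal.tendsto _).comp l2) lim

lemma cm_of_laplace (g F : ℝ → ℝ) (hg : Measurable g) (hg0 : ∀ x, 0 < x → 0 ≤ g x)
    (hInt : ∀ l, 0 ≤ l → IntegrableOn (fun x => Real.exp (-(l * x)) * g x) (Ioi 0))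
    (hF : ∀ l, 0 ≤ l → ∫ x in Ioi (0:ℝ), Real.exp (-(l * x)) * g x = F l) :
    CompletelyMonotoneOn F := by
  set μ : Measure ℝ := (volume.restrict (Ioi 0)).withDensity (fun x => ENNReal.ofReal (g x)) with hμ
  have hgm : Measurable fun x => ENNReal.ofReal (g x) := hg.ennreal_ofReal
  have hi : ∀ f : ℝ → ℝ, ∫ x, f x ∂μ = ∫ x in Ioi (0:ℝ), g x * f x := by
    intro f
    rw [hμ, integral_withDensity_eq_integral_toReal_smul hgm (by simp)]
    refine setIntegral_congr_fun measurableSet_Ioi fun x hx => ?_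
    simp [ENNReal.toReal_ofReal (hg0 x hx)]
  have hsub : Ioi (0:ℝ) ⊆ interior (ProbabilityTheory.integrableExpSet (fun x => -x) μ) := by
    apply interior_maximal _ isOpen_Ioi
    intro l hl
    change Integrable _ _
    rw [hμ, integrable_withDensity_iff_integrable_smul' hgm (by simp)]
    refine (hInt l (le_of_lt hl)).congr_fun (fun x hx => ?_) measurableSet_Ioi
    simp [ENNReal.toReal_ofReal (hg0 x hx), mul_comm]
  have heq : EqOn F (ProbabilityTheory.mgf (fun x => -x) μ) (Ioi 0) := by
    intro l hl
    rw [← hF l (le_of_lt hl), ProbabilityTheory.mgf, hi]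
    refine setIntegral_congr_fun measurableSet_Ioi fun x hx => ?_
    simp [mul_comm]
  constructor
  · refine ContDiffOn.congr ?_ heq
    exact ((ProbabilityTheory.analyticOnNhd_mgf).mono hsub).contDiffOn (uniqueDiffOn_Ioi 0)
  · intro n x hx
    rw [iteratedDerivWithin_congr heq hx, iteratedDerivWithin_of_isOpen isOpen_Ioi hx,
      ProbabilityTheory.iteratedDeriv_mgf (hsub hx), hi, ← integral_const_mul]
    refine setIntegral_nonneg measurableSet_Ioi fun y hy => ?_
    have : (-1 : ℝ) ^ n * (g y * ((-y) ^ n * Real.exp (x * -y))) =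
      g y * (((-1) * (-y)) ^ n * Real.exp (x * -y)) := by rw [mul_pow]; ring
    rw [this]
    have hy' : (0:ℝ) < y := hy
    have := hg0 y hy
    have : 0 ≤ -1 * -y := by linarith
    positivity

/-- complex exponential with rate `c`. -/
noncomputable def cE (c : ℝ) (z : ℂ) : ℂ := Complex.exp (c * z)

lemma cE_diff (c : ℝ) : Differentiable ℂ (cE c) := by unfold cE; fun_prop

lemma cE_deriv (c : ℝ) (z : ℂ) : deriv (cE c) z = c * cE c z := by
  have : HasDerivAt (cE c) (Complex.exp (c * z) * (c * 1)) z :=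
    ((hasDerivAt_id z).const_mul (c : ℂ)).cexp
  rw [this.deriv, cE]; ring

lemma dslope_cE_diff (c : ℝ) (s : ℂ) : Differentiable ℂ (dslope (cE c) s) := by
  rw [← differentiableOn_univ, Complex.differentiableOn_dslope univ_mem]
  exact (cE_diff c).differentiableOn

lemma cE_eq_imp {c : ℝ} (hc : 0 < c) (s : ℝ) {z : ℂ} (hz : |z.im| < 2 * π / c)
    (h : cE c z = cE c s) : z = s := by
  obtain ⟨n, hn⟩ := Complex.exp_eq_exp_iff_exists_int.1 h
  have him := congrArg Complex.im hn
  simp at him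
  rw [lt_div_iff₀ hc] at hz
  have h1 : |(n : ℝ)| * (2 * π) < 1 * (2 * π) := by
    have : |z.im| * c = |(n : ℝ)| * (2 * π) := by
      rw [← abs_of_pos hc, ← abs_mul, mul_comm z.im, him, abs_mul, abs_of_pos two_pi_pos]
    rw [← this]; linarith
  have h2 : |(n : ℝ)| < 1 := lt_of_mul_lt_mul_right h1 two_pi_pos.le
  have h3 : n = 0 := by
    rw [← Int.abs_lt_one_iff]; exact_mod_cast h2
  have hc' : (c : ℂ) ≠ 0 := by exact_mod_cast hc.ne'
  rw [h3] at hn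
  simpa [hc'] using hn

lemma dslope_cE_ne {c : ℝ} (hc : 0 < c) (s : ℝ) {z : ℂ} (hz : |z.im| < 2 * π / c) :
    dslope (cE c) s z ≠ 0 := by
  by_cases h : z = s
  · rw [h, dslope_same, cE_deriv]
    have hc' : (c : ℂ) ≠ 0 := by exact_mod_cast hc.ne'
    exact mul_ne_zero hc' (Complex.exp_ne_zero _)
  · rw [dslope_of_ne _ h, slope_def_field]
    refine div_ne_zero (sub_ne_zero.2 fun h' => h (cE_eq_imp hc s hz h')) (sub_ne_zero.2 h)

/-- the transform in logarithmic coordinates. -/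
noncomputable def Phi (α : ℝ) (z : ℂ) : ℂ := dslope (cE (α - 1)) 0 z / dslope (cE α) 0 z

lemma Phi_of_ne (α : ℝ) {z : ℂ} (hz : z ≠ 0) :
    Phi α z = (cE (α - 1) z - 1) / (cE α z - 1) := by
  rw [Phi, dslope_of_ne _ hz, dslope_of_ne _ hz, slope_def_field, slope_def_field,
    div_div_div_cancel_right₀ (by simpa using hz)]
  simp [cE]

lemma Phi_zero (α : ℝ) : Phi α 0 = ((α - 1) / α : ℝ) := by
  rw [Phi, dslope_same, dslope_same, cE_deriv, cE_deriv]
  simp [cE]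

lemma Phi_log (α : ℝ) {l : ℝ} (hl : 0 < l) : Phi α (Real.log l) =
    ((if l = 1 then (α - 1) / α else (l ^ (α - 1) - 1) / (l ^ α - 1) : ℝ) : ℂ) := by
  have h : ∀ c : ℝ, cE c (Real.log l) = ((l ^ c : ℝ) : ℂ) := by
    intro c
    rw [cE, Real.rpow_def_of_pos hl]; push_cast; rw [mul_comm]
  split_ifs with h1
  · rw [h1]; simpa using Phi_zero α
  · rw [Phi_of_ne, h, h]
    · push_cast; rfl
    · have := Real.log_ne_zero_of_pos_of_ne_one hl h1
      exact_mod_cast this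

lemma Phi_diffOn {α : ℝ} (hα : 1 < α) :
    DifferentiableOn ℂ (Phi α) {z | |z.im| < 2 * π / α} := by
  intro z hz
  refine DifferentiableAt.differentiableWithinAt ?_
  exact ((dslope_cE_diff _ _) z).div ((dslope_cE_diff _ _) z)
    (by simpa using dslope_cE_ne (by linarith : 0 < α) 0 hz)

lemma cE_atBot {c : ℝ} (hc : 0 < c) : Tendsto (cE c) (comap Complex.re atBot) (𝓝 0) := by
  rw [tendsto_zero_iff_norm_tendsto_zero]
  have : (fun z => ‖cE c z‖) = (fun x : ℝ => Real.exp (c * x)) ∘ Complex.re := by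
    ext z; simp [cE, Complex.norm_exp]
  rw [this]
  exact (Real.tendsto_exp_atBot.comp (tendsto_id.const_mul_atBot hc)).comp tendsto_comap

lemma cE_atTop {c : ℝ} (hc : c < 0) : Tendsto (cE c) (comap Complex.re atTop) (𝓝 0) := by
  rw [tendsto_zero_iff_norm_tendsto_zero]
  have : (fun z => ‖cE c z‖) = (fun x : ℝ => Real.exp (c * x)) ∘ Complex.re := by
    ext z; simp [cE, Complex.norm_exp]
  rw [this]
  exact (Real.tendsto_exp_atBot.comp (tendsto_id.const_mul_atTop_of_neg hc)).comp tendsto_comap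

lemma ev_ne_top (s : ℂ) : ∀ᶠ z in comap Complex.re atTop, z ≠ s := by
  filter_upwards [tendsto_comap.eventually (eventually_gt_atTop s.re)] with z hz h
  rw [h] at hz; exact lt_irrefl _ hz

lemma ev_ne_bot (s : ℂ) : ∀ᶠ z in comap Complex.re atBot, z ≠ s := by
  filter_upwards [tendsto_comap.eventually (eventually_lt_atBot s.re)] with z hz h
  rw [h] at hz; exact lt_irrefl _ hz

lemma Phi_top {α : ℝ} (hα : 1 < α) : Tendsto (Phi α) (comap Complex.re atTop) (𝓝 0) := by
  have h1 : Tendsto (fun z => (cE (-1) z - cE (-α) z) / (1 - cE (-α) z))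
      (comap Complex.re atTop) (𝓝 ((0 - 0) / (1 - 0))) :=
    ((cE_atTop (by norm_num)).sub (cE_atTop (by linarith))).div
      (tendsto_const_nhds.sub (cE_atTop (by linarith))) (by norm_num)
  simp only [sub_zero, zero_div] at h1
  refine h1.congr' ?_
  filter_upwards [ev_ne_top 0] with z hz
  rw [Phi_of_ne _ hz, ← mul_div_mul_left (cE (α - 1) z - 1) (cE α z - 1)
    (Complex.exp_ne_zero ((-α : ℝ) * z))]
  congr 1
  · rw [mul_sub, mul_one, cE, cE, cE, ← Complex.exp_add]; congr 2; push_cast; ring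
  · rw [mul_sub, mul_one, cE, cE, ← Complex.exp_add]; simp

lemma Phi_bot {α : ℝ} (hα : 1 < α) : Tendsto (Phi α) (comap Complex.re atBot) (𝓝 1) := by
  have h1 : Tendsto (fun z => (cE (α - 1) z - 1) / (cE α z - 1))
      (comap Complex.re atBot) (𝓝 ((0 - 1) / (0 - 1))) :=
    ((cE_atBot (by linarith)).sub tendsto_const_nhds).div
      ((cE_atBot (by linarith)).sub tendsto_const_nhds) (by norm_num)
  norm_num at h1
  refine h1.congr' ?_
  filter_upwards [ev_ne_bot 0] with z hz
  rw [Phi_of_ne _ hz]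

/-- the density of the mixing measure in logarithmic coordinates. -/
noncomputable def k0 (α x : ℝ) : ℝ :=
  -(Real.sin (π * α) / π) * (Real.exp ((α - 1) * x) + Real.exp (α * x)) /
    ((Real.exp (α * x) - Real.cos (π * α)) ^ 2 + Real.sin (π * α) ^ 2)

lemma sin_neg' {α : ℝ} (h1 : 1 < α) (h2 : α < 2) : Real.sin (π * α) < 0 := by
  have : 0 < Real.sin (π * α - π) := by
    apply Real.sin_pos_of_pos_of_lt_pi <;> nlinarith [pi_pos]
  rw [Real.sin_sub_pi] at this; linarith

lemma k0_nonneg {α : ℝ} (h1 : 1 < α) (h2 : α < 2) (x : ℝ) : 0 ≤ k0 α x := by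
  have := sin_neg' h1 h2
  have h : 0 ≤ -(Real.sin (π * α) / π) := by
    rw [← neg_div]; exact div_nonneg (by linarith) pi_pos.le
  unfold k0; positivity

lemma k0_den {α : ℝ} (h1 : 1 < α) (h2 : α < 2) (x : ℝ) :
    0 < (Real.exp (α * x) - Real.cos (π * α)) ^ 2 + Real.sin (π * α) ^ 2 := by
  have := sin_neg' h1 h2
  nlinarith [sq_nonneg (Real.exp (α * x) - Real.cos (π * α))]

lemma k0_cont {α : ℝ} (h1 : 1 < α) (h2 : α < 2) : Continuous (k0 α) := by
  unfold k0
  refine Continuous.div (by fun_prop) (by fun_prop) fun x => (k0_den h1 h2 x).ne'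

lemma cE_line (c x y : ℝ) : cE c ((x : ℂ) + (y : ℂ) * Complex.I) =
    Real.exp (c * x) * (Real.cos (c * y) + Real.sin (c * y) * Complex.I) := by
  rw [cE, mul_add, Complex.exp_add, ← mul_assoc (c : ℂ) (y : ℂ), Complex.exp_mul_I]
  push_cast; rfl

lemma line_ne (x y : ℝ) (hy : y ≠ 0) (s : ℝ) : (x : ℂ) + (y : ℂ) * Complex.I ≠ s := by
  intro h
  have := congrArg Complex.im h
  simp at this; exact hy this

lemma Phi_jump {α : ℝ} (h1 : 1 < α) (h2 : α < 2) (x : ℝ) :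
    Phi α ((x : ℂ) + ((-π : ℝ) : ℂ) * Complex.I) - Phi α ((x : ℂ) + (π : ℂ) * Complex.I)
      = 2 * π * Complex.I * (k0 α x : ℂ) := by
  have n1 := line_ne x (-π) (by simp [pi_ne_zero]) 0
  have n2 := line_ne x π pi_ne_zero 0
  rw [Complex.ofReal_zero] at n1 n2
  have hs := sin_neg' h1 h2
  have hD := k0_den h1 h2 x
  rw [Phi_of_ne _ n1, Phi_of_ne _ n2]
  simp only [cE_line]
  have e1 : (α - 1) * π = π * α - π := by ring
  have e2 : (α - 1) * -π = -(π * α - π) := by ring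
  have e3 : α * -π = -(π * α) := by ring
  rw [e1, e2, e3, mul_comm α π]
  simp only [Real.cos_neg, Real.sin_neg, Real.cos_sub_pi, Real.sin_sub_pi, k0]
  have hsc := Real.sin_sq_add_cos_sq (π * α)
  generalize Real.sin (π * α) = S at *
  generalize Real.cos (π * α) = C at *
  generalize Real.exp ((α - 1) * x) = Q at *
  have hP : 0 < Real.exp (α * x) := Real.exp_pos _
  generalize Real.exp (α * x) = P at *
  have hpi : (π : ℂ) ≠ 0 := by exact_mod_cast pi_ne_zero
  have d1 : (P : ℂ) * (C + S * Complex.I) - 1 ≠ 0 := by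
    intro h
    have := congrArg Complex.im h
    simp at this
    rcases this with h | h <;> linarith
  have d2 : (P : ℂ) * (C + (-S : ℝ) * Complex.I) - 1 ≠ 0 := by
    intro h
    have := congrArg Complex.im h
    simp at this
    rcases this with h | h <;> linarith
  have d3 : (((P - C) ^ 2 + S ^ 2 : ℝ) : ℂ) ≠ 0 := by exact_mod_cast hD.ne'
  have hsc' : (S : ℂ) ^ 2 + (C : ℂ) ^ 2 = 1 := by exact_mod_cast hsc
  rw [div_sub_div _ _ d2 d1]
  have d4 : ((P : ℂ) * (C + (-S : ℝ) * Complex.I) - 1) * ((P : ℂ) * (C + S * Complex.I) - 1) =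
      (((P - C) ^ 2 + S ^ 2 : ℝ) : ℂ) := by
    push_cast
    linear_combination ((P : ℂ) ^ 2 - 1) * hsc' - (P : ℂ) ^ 2 * S ^ 2 * Complex.I_sq
  rw [d4]
  push_cast at d3 ⊢
  field_simp
  linear_combination 0 * hsc'

/-- the Cauchy quotient in logarithmic coordinates. -/
noncomputable def Hq (α s : ℝ) (z : ℂ) : ℂ :=
  dslope (Phi α) s z * cE 1 z / dslope (cE 1) s z

lemma Hq_of_ne (α s : ℝ) {z : ℂ} (hz : z ≠ s) :
    Hq α s z = (Phi α z - Phi α s) * cE 1 z / (cE 1 z - cE 1 s) := by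
  have h : z - (s : ℂ) ≠ 0 := sub_ne_zero.2 hz
  rw [Hq, dslope_of_ne _ hz, dslope_of_ne _ hz, slope_def_field, slope_def_field,
    div_mul_eq_mul_div, div_div_div_cancel_right₀ h]

lemma strip_lt {α : ℝ} (h1 : 1 < α) (h2 : α < 2) {y : ℝ} (hy : |y| ≤ π) : |y| < 2 * π / α := by
  refine lt_of_le_of_lt hy ?_
  rw [lt_div_iff₀ (by linarith)]
  nlinarith [pi_pos]

lemma strip_open (α : ℝ) : IsOpen {z : ℂ | |z.im| < 2 * π / α} :=
  isOpen_lt (by fun_prop) (by fun_prop)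

lemma Hq_diff {α : ℝ} (h1 : 1 < α) (h2 : α < 2) (s : ℝ) (z : ℂ) (hz : |z.im| ≤ π) :
    DifferentiableAt ℂ (Hq α s) z := by
  have hU := strip_open α
  have hs : (s : ℂ) ∈ {z : ℂ | |z.im| < 2 * π / α} := by
    have : 0 < 2 * π / α := div_pos two_pi_pos (by linarith)
    simpa using this
  have hd := (Complex.differentiableOn_dslope (hU.mem_nhds hs)).2 (Phi_diffOn h1)
  have hdz := hd.differentiableAt (hU.mem_nhds (strip_lt h1 h2 hz))
  refine (hdz.mul (cE_diff 1 z)).div (dslope_cE_diff 1 s z) (dslope_cE_ne one_pos s ?_)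
  have := pi_pos
  linarith

lemma cE_one_ofReal (s : ℝ) : cE 1 s = (Real.exp s : ℂ) := by
  simp [cE]

lemma Hq_top {α : ℝ} (h1 : 1 < α) (s : ℝ) :
    Tendsto (Hq α s) (comap Complex.re atTop) (𝓝 (-Phi α s)) := by
  have h : Tendsto (fun z => (Phi α z - Phi α s) / (1 - cE 1 s * cE (-1) z))
      (comap Complex.re atTop) (𝓝 ((0 - Phi α s) / (1 - cE 1 s * 0))) :=
    ((Phi_top h1).sub tendsto_const_nhds).div
      (tendsto_const_nhds.sub ((cE_atTop (by norm_num)).const_mul _)) (by norm_num)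
  simp only [zero_sub, mul_zero, sub_zero, div_one] at h
  refine h.congr' ?_
  filter_upwards [ev_ne_top s] with z hz
  rw [Hq_of_ne _ _ hz, ← mul_div_mul_right (Phi α z - Phi α s) _
    (Complex.exp_ne_zero ((1 : ℝ) * z))]
  congr 1
  have : cE (-1) z * Complex.exp ((1 : ℝ) * z) = 1 := by
    rw [cE, ← Complex.exp_add]; simp
  rw [sub_mul, mul_assoc, this]; simp [cE]

lemma Hq_bot {α : ℝ} (h1 : 1 < α) (s : ℝ) :
    Tendsto (Hq α s) (comap Complex.re atBot) (𝓝 0) := by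
  have h : Tendsto (fun z => (Phi α z - Phi α s) * cE 1 z / (cE 1 z - cE 1 s))
      (comap Complex.re atBot) (𝓝 ((1 - Phi α s) * 0 / (0 - cE 1 s))) :=
    (((Phi_bot h1).sub tendsto_const_nhds).mul (cE_atBot one_pos)).div
      ((cE_atBot one_pos).sub tendsto_const_nhds)
      (by rw [zero_sub]; exact neg_ne_zero.2 (Complex.exp_ne_zero _))
  simp only [mul_zero, zero_div] at h
  refine h.congr' ?_
  filter_upwards [ev_ne_bot s] with z hz
  rw [Hq_of_ne _ _ hz]

lemma Hq_jump {α : ℝ} (h1 : 1 < α) (h2 : α < 2) (s x : ℝ) :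
    Hq α s ((x : ℂ) + ((-π : ℝ) : ℂ) * Complex.I) - Hq α s ((x : ℂ) + (π : ℂ) * Complex.I)
      = 2 * π * Complex.I * ((k0 α x * Real.exp x / (Real.exp s + Real.exp x) : ℝ) : ℂ) := by
  rw [Hq_of_ne _ _ (line_ne x (-π) (by simp [pi_ne_zero]) s),
    Hq_of_ne _ _ (line_ne x π pi_ne_zero s)]
  have e1 : cE 1 ((x : ℂ) + ((-π : ℝ) : ℂ) * Complex.I) = -(Real.exp x : ℂ) := by
    rw [cE_line]; simp
  have e2 : cE 1 ((x : ℂ) + (π : ℂ) * Complex.I) = -(Real.exp x : ℂ) := by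
    rw [cE_line]; simp
  rw [e1, e2, cE_one_ofReal, ← sub_div, ← sub_mul, sub_sub_sub_cancel_right, Phi_jump h1 h2]
  have hne : (Real.exp s : ℂ) + Real.exp x ≠ 0 := by
    have : Real.exp s + Real.exp x ≠ 0 := by positivity
    exact_mod_cast this
  have hne' : -(Real.exp x : ℂ) - Real.exp s ≠ 0 := by
    intro h; apply hne; linear_combination -h
  rw [Complex.ofReal_div, Complex.ofReal_mul, Complex.ofReal_add]
  rw [mul_div_assoc', div_eq_div_iff hne' hne]
  ring

lemma stieltjes {α : ℝ} (h1 : 1 < α) (h2 : α < 2) (l : ℝ) (hl : 0 ≤ l) :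
    Integrable (fun x => k0 α x * Real.exp x / (l + Real.exp x)) ∧
    ∫ x, k0 α x * Real.exp x / (l + Real.exp x) =
      if l = 1 then (α - 1) / α else (l ^ (α - 1) - 1) / (l ^ α - 1) := by
  have hk := k0_cont h1 h2
  rcases hl.eq_or_lt with rfl | hl
  · have e : (fun x => k0 α x * Real.exp x / (0 + Real.exp x)) = k0 α := by
      ext x; rw [zero_add, mul_div_assoc, div_self (Real.exp_ne_zero x), mul_one]
    rw [e]
    obtain ⟨a, b⟩ := strip_integral (Phi α)
      (fun z hz => (Phi_diffOn h1).differentiableAt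
        ((strip_open α).mem_nhds (strip_lt h1 h2 hz))) 0 1 (Phi_top h1) (Phi_bot h1)
      (k0 α) hk (k0_nonneg h1 h2) (Phi_jump h1 h2)
    refine ⟨a, ?_⟩
    rw [sub_zero] at b
    rw [Real.zero_rpow (by linarith), Real.zero_rpow (by linarith)]
    norm_num
    exact_mod_cast b
  · have hs := Real.exp_log hl
    obtain ⟨a, b⟩ := strip_integral (Hq α (Real.log l)) (Hq_diff h1 h2 _) _ _
      (Hq_top h1 _) (Hq_bot h1 _)
      (fun x => k0 α x * Real.exp x / (Real.exp (Real.log l) + Real.exp x))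
      (Continuous.div (by fun_prop) (by fun_prop) fun x => by positivity)
      (fun x => by have := k0_nonneg h1 h2 x; positivity) (Hq_jump h1 h2 _)
    rw [hs] at a b
    refine ⟨a, ?_⟩
    rw [Phi_log α hl, zero_sub, neg_neg] at b
    exact_mod_cast b

lemma laplace_fubini (k : ℝ → ℝ) (hk : Continuous k) (hk0 : ∀ t, 0 ≤ k t) (l : ℝ) (hl : 0 ≤ l)
    (hi : Integrable (fun t => k t / (l + Real.exp t))) :
    IntegrableOn (fun x => Real.exp (-(l * x)) * ∫ t, Real.exp (-(x * Real.exp t)) * k t) (Ioi 0) ∧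
    ∫ x in Ioi (0:ℝ), Real.exp (-(l * x)) * ∫ t, Real.exp (-(x * Real.exp t)) * k t =
      ∫ t, k t / (l + Real.exp t) := by
  have hpos : ∀ t, 0 < l + Real.exp t := fun t => by positivity
  have hrw : ∀ x t, Real.exp (-(l * x)) * (Real.exp (-(x * Real.exp t)) * k t) =
      Real.exp (-(l + Real.exp t) * x) * k t := by
    intro x t
    rw [← mul_assoc, ← Real.exp_add]; congr 2; ring
  have hin : ∀ t, ∫ x in Ioi (0:ℝ), Real.exp (-(l + Real.exp t) * x) * k t =
      k t / (l + Real.exp t) := by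
    intro t
    rw [integral_mul_const, integral_exp_mul_Ioi (by linarith [hpos t])]
    rw [mul_zero, Real.exp_zero, neg_div_neg_eq]
    ring
  have hprod : Integrable (Function.uncurry fun x t => Real.exp (-(l + Real.exp t) * x) * k t)
      ((volume.restrict (Ioi (0:ℝ))).prod volume) := by
    rw [integrable_prod_iff' (by
      apply Continuous.aestronglyMeasurable
      unfold Function.uncurry
      fun_prop)]
    constructor
    · refine ae_of_all _ fun t => ?_
      exact (integrableOn_exp_mul_Ioi (neg_lt_zero.2 (hpos t)) 0).mul_const (k t)
    · refine hi.congr (ae_of_all _ fun t => ?_)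
      simp only [Function.uncurry, norm_mul, Real.norm_eq_abs, abs_of_nonneg (hk0 t),
        Real.abs_exp]
      rw [hin]
  simp_rw [← integral_const_mul, hrw]
  refine ⟨hprod.integral_prod_left, ?_⟩
  rw [integral_integral_swap hprod]
  simp_rw [hin]

lemma finish (α : ℝ) (hα : α ∈ Ioc (1:ℝ) 2) (g : ℝ → ℝ) (hg : Measurable g)
    (hg0 : ∀ x, 0 < x → 0 ≤ g x)
    (hInt : ∀ l, 0 ≤ l → IntegrableOn (fun x => Real.exp (-(l * x)) * g x) (Ioi 0))
    (hF : ∀ l : ℝ, 0 ≤ l → ∫ x in Ioi (0:ℝ), Real.exp (-(l * x)) * g x =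
      if l = 1 then (α - 1) / α else (l ^ (α - 1) - 1) / (l ^ α - 1)) :
    ∃ g : ℝ → ℝ,
      (∀ x : ℝ, 0 < x → 0 ≤ g x) ∧
      (∫ x in Ioi (0:ℝ), g x = 1) ∧
      (∀ l : ℝ, 0 ≤ l →
        ∫ x in Ioi (0:ℝ), Real.exp (-(l * x)) * g x =
          if l = 1 then (α - 1) / α else (l ^ (α - 1) - 1) / (l ^ α - 1)) ∧
      (if (0:ℝ) = 1 then (α - 1) / α else ((0:ℝ) ^ (α - 1) - 1) / ((0:ℝ) ^ α - 1)) = 1 ∧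
      CompletelyMonotoneOn
        (fun l : ℝ => if l = 1 then (α - 1) / α else (l ^ (α - 1) - 1) / (l ^ α - 1)) := by
  have h0 : (if (0:ℝ) = 1 then (α - 1) / α else ((0:ℝ) ^ (α - 1) - 1) / ((0:ℝ) ^ α - 1)) = 1 := by
    have := hα.1
    rw [Real.zero_rpow (by linarith), Real.zero_rpow (by linarith)]
    norm_num
  refine ⟨g, hg0, ?_, hF, h0, cm_of_laplace g _ hg hg0 hInt hF⟩
  have := hF 0 le_rfl
  rw [h0] at this
  simpa using this

/-- For `α ∈ (1,2]`, `λ ↦ (λ^{α-1}-1)/(λ^α-1)` (value `(α-1)/α` at `λ = 1`) is the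
Laplace transform of a probability density on `(0,∞)`; its value at `0` is `1` and it
is completely monotone. -/
theorem laplace_transform_Galpha (α : ℝ) (hα : α ∈ Ioc (1:ℝ) 2) :
    ∃ g : ℝ → ℝ,
      (∀ x : ℝ, 0 < x → 0 ≤ g x) ∧
      (∫ x in Ioi (0:ℝ), g x = 1) ∧
      (∀ l : ℝ, 0 ≤ l →
        ∫ x in Ioi (0:ℝ), Real.exp (-(l * x)) * g x =
          if l = 1 then (α - 1) / α else (l ^ (α - 1) - 1) / (l ^ α - 1)) ∧
      (if (0:ℝ) = 1 then (α - 1) / α else ((0:ℝ) ^ (α - 1) - 1) / ((0:ℝ) ^ α - 1)) = 1 ∧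
      CompletelyMonotoneOn
        (fun l : ℝ => if l = 1 then (α - 1) / α else (l ^ (α - 1) - 1) / (l ^ α - 1)) := by

  rcases hα.2.eq_or_lt with rfl | h2
  · have hrw : ∀ l x : ℝ, Real.exp (-(l * x)) * Real.exp (-x) = Real.exp (-(l + 1) * x) := by
      intro l x; rw [← Real.exp_add]; congr 1; ring
    refine finish 2 hα (fun x => Real.exp (-x)) (by fun_prop) (fun x _ => (Real.exp_pos _).le) ?_ ?_
    · intro l hl
      simp_rw [hrw]
      exact integrableOn_exp_mul_Ioi (by linarith) 0
    · intro l hl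
      simp_rw [hrw]
      rw [integral_exp_mul_Ioi (by linarith)]
      have e1 : (2:ℝ) - 1 = 1 := by norm_num
      rw [e1, Real.rpow_one, Real.rpow_two]
      split_ifs with h
      · rw [h]; norm_num
      · have h3 : l - 1 ≠ 0 := sub_ne_zero.2 h
        have h4 : l + 1 ≠ 0 := by linarith
        have h5 : l ^ 2 - 1 = (l - 1) * (l + 1) := by ring
        rw [h5]
        simp only [mul_zero, Real.exp_zero]
        rw [neg_div_neg_eq]
        field_simp
  · have h1 := hα.1
    have hk : Continuous fun t => k0 α t * Real.exp t := (k0_cont h1 h2).mul Real.continuous_exp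
    have hk0 : ∀ t, 0 ≤ k0 α t * Real.exp t :=
      fun t => mul_nonneg (k0_nonneg h1 h2 t) (Real.exp_pos t).le
    refine finish α hα (fun x => ∫ t, Real.exp (-(x * Real.exp t)) * (k0 α t * Real.exp t))
      ?_ ?_ ?_ ?_
    · have : StronglyMeasurable (Function.uncurry
          fun x t : ℝ => Real.exp (-(x * Real.exp t)) * (k0 α t * Real.exp t)) := by
        apply Continuous.stronglyMeasurable
        unfold Function.uncurry
        have := k0_cont h1 h2
        fun_prop
      exact this.integral_prod_right.measurable
    · intro x _
      exact integral_nonneg fun t => mul_nonneg (Real.exp_pos _).le (hk0 t)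
    · intro l hl
      exact (laplace_fubini _ hk hk0 l hl (stieltjes h1 h2 l hl).1).1
    · intro l hl
      rw [← (stieltjes h1 h2 l hl).2]
      exact (laplace_fubini _ hk hk0 l hl (stieltjes h1 h2 l hl).1).2
end

section
/- For α ∈ (0,1/2], c = cos(πα) and t ∈ (0, 1-α], let X_{c,t} be the random variable with Laplace transform 1/(1 + 2cλ^t + λ^{2t}); then E[X_{c,t}^{-x}] = (Γ(1-x/t)Γ(1+x/t)/Γ(1+x)) · sin(πα(1 - x/t))/sin(πα) for x ∈ [0,t). -/
open Real Set MeasureTheory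

lemma aux_real (s r : ℝ) (hs0 : 0 < s) (hs1 : s < 1) (hr : 0 < r) :
    ∫ u in Ioi (0:ℝ), u ^ (s - 1) / (u + r) =
      r ^ (s - 1) * (Real.Gamma s * Real.Gamma (1 - s)) := by
  set ν : Measure ℝ := volume.restrict (Ioi 0) with hν
  have hpos : ∀ᵐ u ∂ν, 0 < u := ae_restrict_mem measurableSet_Ioi
  have key : ∀ y : ℝ, 0 < y → ∫ u, u ^ (s - 1) * exp (-(y * u)) * exp (-(r * y)) ∂ν
      = Real.Gamma s * (y ^ ((1 - s) - 1) * exp (-(r * y))) := by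
    intro y hy
    rw [integral_mul_const, hν, Real.integral_rpow_mul_exp_neg_mul_Ioi hs0 hy, one_div,
      Real.inv_rpow hy.le, ← Real.rpow_neg hy.le]
    ring_nf
  have hΓ := Real.Gamma_pos_of_pos hs0
  have hΓ' := Real.Gamma_pos_of_pos (sub_pos.2 hs1)
  have hint : Integrable (Function.uncurry
      (fun u y : ℝ => u ^ (s - 1) * exp (-(y * u)) * exp (-(r * y)))) (ν.prod ν) := by
    rw [integrable_prod_iff' (by apply Measurable.aestronglyMeasurable; fun_prop)]
    constructor
    · filter_upwards [hpos] with y hy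
      apply Integrable.of_integral_ne_zero
      simp only [Function.uncurry_apply_pair]
      rw [key y hy]
      positivity
    · have h1 : Integrable (fun y : ℝ => Real.Gamma s * (y ^ ((1 - s) - 1) * exp (-(r * y)))) ν := by
        apply Integrable.const_mul
        apply Integrable.of_integral_ne_zero
        rw [hν, Real.integral_rpow_mul_exp_neg_mul_Ioi (sub_pos.2 hs1) hr]
        positivity
      refine h1.congr ?_
      filter_upwards [hpos] with y hy
      rw [← key y hy]
      apply integral_congr_ae
      filter_upwards [hpos] with u hu
      simp only [Function.uncurry_apply_pair]
      rw [Real.norm_of_nonneg (by positivity)]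
  have hsw := integral_integral_swap hint
  have hL : ∫ u, ∫ y, u ^ (s - 1) * exp (-(y * u)) * exp (-(r * y)) ∂ν ∂ν
      = ∫ u, u ^ (s - 1) / (u + r) ∂ν := by
    apply integral_congr_ae
    filter_upwards [hpos] with u hu
    have : ∀ y, u ^ (s - 1) * exp (-(y * u)) * exp (-(r * y))
        = u ^ (s - 1) * exp ((-(u + r)) * y) := by
      intro y; rw [mul_assoc, ← Real.exp_add]; ring_nf
    simp_rw [this]
    rw [integral_const_mul, hν, integral_exp_mul_Ioi (by linarith)]
    simp [div_eq_mul_inv, ← inv_neg]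
  rw [← hL, hsw]
  have hR : ∫ y, ∫ u, u ^ (s - 1) * exp (-(y * u)) * exp (-(r * y)) ∂ν ∂ν
      = ∫ y, Real.Gamma s * (y ^ ((1 - s) - 1) * exp (-(r * y))) ∂ν := by
    apply integral_congr_ae
    filter_upwards [hpos] with y hy
    exact key y hy
  rw [hR, integral_const_mul, hν, Real.integral_rpow_mul_exp_neg_mul_Ioi (sub_pos.2 hs1) hr, one_div,
      Real.inv_rpow hr.le, ← Real.rpow_neg hr.le]
  ring_nf

lemma aux_int (s r : ℝ) (hs0 : 0 < s) (hs1 : s < 1) (hr : 0 < r) :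
    IntegrableOn (fun u : ℝ => u ^ (s - 1) / (u + r)) (Ioi (0:ℝ)) := by
  apply Integrable.of_integral_ne_zero
  rw [aux_real s r hs0 hs1 hr]
  have hΓ := Real.Gamma_pos_of_pos hs0
  have hΓ' := Real.Gamma_pos_of_pos (sub_pos.2 hs1)
  positivity

lemma aux_bound (u : ℝ) (z : ℂ) : u + (z.re + z.im) ≤ 2 * ‖(u:ℂ) + z‖ := by
  have h1 := Complex.re_le_norm ((u:ℂ) + z)
  have h2 := Complex.abs_im_le_norm ((u:ℂ) + z)
  have h3 := le_abs_self ((u:ℂ) + z).im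
  simp at h1 h2 h3
  linarith

lemma aux_ne (u : ℝ) (z : ℂ) (hz : 0 < u + (z.re + z.im)) : (u:ℂ) + z ≠ 0 := by
  have := aux_bound u z
  intro h
  rw [h, norm_zero] at this
  linarith

lemma aux_cint (s : ℝ) (hs0 : 0 < s) (hs1 : s < 1) (z : ℂ) (hz : 0 < z.re + z.im) :
    IntegrableOn (fun u : ℝ => ((u ^ (s - 1) : ℝ) : ℂ) / (u + z)) (Ioi (0:ℝ)) := by
  refine Integrable.mono' ((aux_int s _ hs0 hs1 hz).const_mul 2)
    (by apply Measurable.aestronglyMeasurable; fun_prop) ?_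
  filter_upwards [ae_restrict_mem measurableSet_Ioi] with u hu
  have hu : 0 < u := hu
  rw [norm_div, Complex.norm_real, Real.norm_of_nonneg (by positivity)]
  have h := aux_bound u z
  rw [← mul_div_assoc, div_le_div_iff₀ (by linarith) (by linarith)]
  have : 0 ≤ u ^ (s-1) := by positivity
  nlinarith

lemma aux_diff (s : ℝ) (hs0 : 0 < s) (hs1 : s < 1) (z : ℂ) (hz : 0 < z.re + z.im) :
    DifferentiableAt ℂ (fun z : ℂ => ∫ u in Ioi (0:ℝ), ((u ^ (s - 1) : ℝ) : ℂ) / (u + z)) z := by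
  set δ := (z.re + z.im) / 2 with hδ
  have hδ0 : 0 < δ := by positivity
  have hN : {w : ℂ | δ < w.re + w.im} ∈ nhds z := by
    apply IsOpen.mem_nhds
    · exact isOpen_lt continuous_const (by fun_prop)
    · change δ < z.re + z.im; linarith
  have := hasDerivAt_integral_of_dominated_loc_of_deriv_le (μ := volume.restrict (Ioi (0:ℝ)))
    (F := fun (z : ℂ) (u : ℝ) => ((u ^ (s - 1) : ℝ) : ℂ) / (u + z))
    (F' := fun (z : ℂ) (u : ℝ) => -((u ^ (s - 1) : ℝ) : ℂ) / (u + z) ^ 2) (x₀ := z)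
    (bound := fun u => 4 / δ * (u ^ (s - 1) / (u + δ))) hN
    (Filter.Eventually.of_forall fun w => by apply Measurable.aestronglyMeasurable; fun_prop)
    (aux_cint s hs0 hs1 z hz)
    (by apply Measurable.aestronglyMeasurable; fun_prop)
    ?_ ((aux_int s δ hs0 hs1 hδ0).const_mul _) ?_
  · exact this.2.differentiableAt
  · filter_upwards [ae_restrict_mem measurableSet_Ioi] with u hu w hw
    have hu : 0 < u := hu
    have hw : δ < w.re + w.im := hw
    have h := aux_bound u w
    have hp : 0 ≤ u ^ (s-1) := by positivity
    rw [norm_div, norm_neg, Complex.norm_real, Real.norm_of_nonneg hp, norm_pow,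
      div_mul_div_comm, div_le_div_iff₀ (by have : 0 < ‖(u:ℂ) + w‖ := by linarith
                                            positivity) (by positivity)]
    have h1 : u + δ ≤ 2 * ‖(u:ℂ) + w‖ := by linarith
    have h2 : δ ≤ 2 * ‖(u:ℂ) + w‖ := by linarith
    have h3 : δ * (u + δ) ≤ 4 * ‖(u:ℂ) + w‖ ^ 2 := by nlinarith
    nlinarith
  · filter_upwards [ae_restrict_mem measurableSet_Ioi] with u hu w hw
    have hu : 0 < u := hu
    have hw : δ < w.re + w.im := hw
    have hne := aux_ne u w (by linarith)
    have h1 : HasDerivAt (fun w : ℂ => (u:ℂ) + w) 1 w := (hasDerivAt_id w).const_add _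
    have := (hasDerivAt_const w ((u ^ (s - 1) : ℝ) : ℂ)).div h1 hne
    rw [zero_mul, mul_one, zero_sub] at this
    exact this

lemma aux_complex (s : ℝ) (hs0 : 0 < s) (hs1 : s < 1) (z : ℂ) (hz : 0 < z.re + z.im) :
    ∫ u in Ioi (0:ℝ), ((u ^ (s - 1) : ℝ) : ℂ) / (u + z) =
      z ^ ((s : ℂ) - 1) * ((Real.Gamma s * Real.Gamma (1 - s) : ℝ) : ℂ) := by
  set U : Set ℂ := {w : ℂ | 0 < w.re + w.im} with hU
  have hUo : IsOpen U := isOpen_lt continuous_const (by fun_prop)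
  have hUc : IsPreconnected U := by
    apply Convex.isPreconnected
    have : U = (Complex.reLm + Complex.imLm) ⁻¹' (Ioi 0) := by
      ext; simp [hU]
    rw [this]
    exact (convex_Ioi 0).linear_preimage _
  have hsub : U ⊆ Complex.slitPlane := by
    intro w hw
    have hw : 0 < w.re + w.im := hw
    rw [Complex.mem_slitPlane_iff]
    by_contra! h
    rw [h.2] at hw
    linarith [h.1]
  have hf : AnalyticOnNhd ℂ (fun z : ℂ => ∫ u in Ioi (0:ℝ), ((u ^ (s - 1) : ℝ) : ℂ) / (u + z)) U :=
    DifferentiableOn.analyticOnNhd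
      (fun w hw => (aux_diff s hs0 hs1 w hw).differentiableWithinAt) hUo
  have hg : AnalyticOnNhd ℂ (fun z : ℂ => z ^ ((s : ℂ) - 1) *
      ((Real.Gamma s * Real.Gamma (1 - s) : ℝ) : ℂ)) U :=
    DifferentiableOn.analyticOnNhd
      (fun w hw => (((differentiableAt_id).cpow_const (hsub hw)).mul_const _).differentiableWithinAt) hUo
  refine hf.eqOn_of_preconnected_of_frequently_eq hg hUc (z₀ := 1) (by simp [hU]) ?_ hz
  have hreal : ∀ r : ℝ, 0 < r → ∫ u in Ioi (0:ℝ), ((u ^ (s - 1) : ℝ) : ℂ) / (u + (r:ℂ)) =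
      (r:ℂ) ^ ((s : ℂ) - 1) * ((Real.Gamma s * Real.Gamma (1 - s) : ℝ) : ℂ) := by
    intro r hr
    have h := congrArg (fun x : ℝ => (x : ℂ)) (aux_real s r hs0 hs1 hr)
    rw [← integral_complex_ofReal] at h
    push_cast [Complex.ofReal_cpow hr.le] at h ⊢
    exact h
  have ht : Filter.Tendsto (fun n : ℕ => ((1 + 1 / ((n:ℝ) + 1) : ℝ) : ℂ)) Filter.atTop
      (nhdsWithin 1 {1}ᶜ) := by
    rw [tendsto_nhdsWithin_iff]
    constructor
    · have h := (tendsto_one_div_add_atTop_nhds_zero_nat (𝕜 := ℝ)).const_add 1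
      rw [add_zero] at h
      have := (Complex.continuous_ofReal.tendsto 1).comp h
      simpa [Function.comp_def] using this
    · refine Filter.Eventually.of_forall fun n => ?_
      simp only [mem_compl_iff, mem_singleton_iff]
      intro h
      have h : (1 + 1 / ((n:ℝ) + 1) : ℝ) = 1 := by exact_mod_cast h
      have : 0 < 1 / ((n:ℝ) + 1) := by positivity
      linarith
  exact ht.frequently (Filter.Frequently.of_forall fun n => hreal _ (by positivity))

lemma aux_kernel (s θ : ℝ) (hs0 : 0 < s) (hs1 : s < 1) (h0 : 0 < θ) (h1 : θ ≤ π / 2) :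
    ∫ u in Ioi (0:ℝ), u ^ (s - 1) / (1 + 2 * cos θ * u + u ^ 2) =
      Real.Gamma s * Real.Gamma (1 - s) * (sin (θ * (1 - s)) / sin θ) := by
  have hsin : 0 < sin θ := sin_pos_of_pos_of_lt_pi h0 (by linarith [pi_pos])
  have hcos : 0 ≤ cos θ := cos_nonneg_of_mem_Icc ⟨by linarith [pi_pos], h1⟩
  set z : ℂ := Complex.exp (θ * Complex.I) with hz
  have hre : z.re = cos θ := Complex.exp_ofReal_mul_I_re θ
  have him : z.im = sin θ := Complex.exp_ofReal_mul_I_im θ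
  have hzz : 0 < z.re + z.im := by rw [hre, him]; linarith
  have h := congrArg Complex.im (aux_complex s hs0 hs1 z hzz)
  have h2 := integral_im (aux_cint s hs0 hs1 z hzz)
  simp only [RCLike.im_to_complex] at h2
  rw [← h2] at h
  have hpow : z ^ ((s : ℂ) - 1) = Complex.exp (((θ * (s - 1) : ℝ) : ℂ) * Complex.I) := by
    rw [Complex.cpow_def_of_ne_zero (Complex.exp_ne_zero _),
      Complex.log_exp (by simp; linarith [pi_pos]) (by simp; linarith [pi_pos])]
    congr 1
    push_cast; ring
  rw [hpow, Complex.im_mul_ofReal, Complex.exp_ofReal_mul_I_im] at h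
  have h3 : ∫ u in Ioi (0:ℝ), (((u ^ (s - 1) : ℝ) : ℂ) / (u + z)).im
      = ∫ u in Ioi (0:ℝ), (- sin θ) * (u ^ (s - 1) / (1 + 2 * cos θ * u + u ^ 2)) := by
    apply setIntegral_congr_fun measurableSet_Ioi
    intro u hu
    have hu : 0 < u := hu
    simp only
    rw [Complex.div_im, Complex.normSq_apply]
    simp only [Complex.ofReal_im, Complex.ofReal_re, Complex.add_re, Complex.add_im, hre, him]
    have e : (u + cos θ) * (u + cos θ) + (0 + sin θ) * (0 + sin θ) = 1 + 2 * cos θ * u + u ^ 2 := by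
      have := sin_sq_add_cos_sq θ
      linear_combination this
    rw [e]
    ring
  rw [h3, integral_const_mul] at h
  have h4 : sin (θ * (s - 1)) = - sin (θ * (1 - s)) := by
    rw [← sin_neg]; ring_nf
  rw [h4] at h
  rw [← mul_div_assoc, eq_div_iff hsin.ne']
  linarith

theorem neg_moment_X {Ω : Type*} [MeasurableSpace Ω] (μ : Measure Ω)
    [IsProbabilityMeasure μ] (α t : ℝ) (hα : α ∈ Ioc (0:ℝ) (1/2))
    (ht : t ∈ Ioc (0:ℝ) (1 - α)) (X : Ω → ℝ) (hXpos : ∀ᵐ ω ∂μ, 0 < X ω)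
    (hLap : ∀ l : ℝ, 0 ≤ l →
      ∫ ω, Real.exp (-(l * X ω)) ∂μ =
        1 / (1 + 2 * Real.cos (π * α) * l ^ t + l ^ (2 * t)))
    (x : ℝ) (hx : x ∈ Ico (0:ℝ) t) :
    ∫ ω, (X ω) ^ (-x) ∂μ =
      Real.Gamma (1 - x / t) * Real.Gamma (1 + x / t) / Real.Gamma (1 + x) *
        (Real.sin (π * α * (1 - x / t)) / Real.sin (π * α)) := by
  obtain ⟨ha0, ha1⟩ := hα
  obtain ⟨ht0, ht1⟩ := ht
  obtain ⟨hx0, hxt⟩ := hx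
  have hθ0 : 0 < π * α := by positivity
  have hθ1 : π * α ≤ π / 2 := by nlinarith [pi_pos]
  have hsin : 0 < sin (π * α) := sin_pos_of_pos_of_lt_pi hθ0 (by linarith [pi_pos])
  have hcos : 0 ≤ cos (π * α) := cos_nonneg_of_mem_Icc ⟨by linarith [pi_pos], hθ1⟩
  rcases hx0.eq_or_lt with rfl | hx0
  · simp [hsin.ne']
  have hLapint : ∀ l : ℝ, 0 < l → Integrable (fun ω => Real.exp (-(l * X ω))) μ := by
    intro l hl
    apply Integrable.of_integral_ne_zero
    rw [hLap l hl.le]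
    positivity
  have hXm : AEMeasurable X μ := by
    have h1 := (hLapint 1 one_pos).aestronglyMeasurable.aemeasurable
    have h2 := (Real.measurable_log.comp_aemeasurable h1).neg
    refine h2.congr (Filter.Eventually.of_forall fun ω => ?_)
    simp
  set s := x / t with hs
  have hs0 : 0 < s := by positivity
  have hs1 : s < 1 := by rw [hs, div_lt_one ht0]; exact hxt
  have hst : s * t = x := by rw [hs]; field_simp
  have hk := aux_kernel s (π * α) hs0 hs1 hθ0 hθ1
  have hΓx := Real.Gamma_pos_of_pos hx0
  have hΓ := Real.Gamma_pos_of_pos hs0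
  have hΓ' := Real.Gamma_pos_of_pos (sub_pos.2 hs1)
  have hsin2 : 0 < sin (π * α * (1 - s)) := by
    apply sin_pos_of_pos_of_lt_pi
    · exact mul_pos hθ0 (by linarith)
    · nlinarith [pi_pos]
  -- change of variables
  have hcv : ∫ l in Ioi (0:ℝ), l ^ (x - 1) *
      (1 / (1 + 2 * Real.cos (π * α) * l ^ t + l ^ (2 * t))) =
      (1 / t) * (Real.Gamma s * Real.Gamma (1 - s) * (sin (π * α * (1 - s)) / sin (π * α))) := by
    rw [← hk, ← integral_comp_rpow_Ioi_of_pos (g := fun u : ℝ =>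
      u ^ (s - 1) / (1 + 2 * cos (π * α) * u + u ^ 2)) ht0, ← integral_const_mul]
    apply setIntegral_congr_fun measurableSet_Ioi
    intro l hl
    have hl : 0 < l := hl
    simp only [smul_eq_mul]
    have e1 : l ^ (2 * t) = (l ^ t) ^ 2 := by
      rw [mul_comm, Real.rpow_mul hl.le]; norm_cast
    have e2 : l ^ (x - 1) = l ^ (t - 1) * (l ^ t) ^ (s - 1) := by
      rw [← Real.rpow_mul hl.le, ← Real.rpow_add hl]
      congr 1
      rw [← hst]; ring
    rw [e1, e2]
    field_simp
  set ν : Measure ℝ := volume.restrict (Ioi 0) with hν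
  have hpos : ∀ᵐ u ∂ν, 0 < u := ae_restrict_mem measurableSet_Ioi
  have hin : ∀ l : ℝ, 0 < l → ∫ ω, l ^ (x - 1) * exp (-(l * X ω)) ∂μ = l ^ (x - 1) *
      (1 / (1 + 2 * Real.cos (π * α) * l ^ t + l ^ (2 * t))) := by
    intro l hl
    rw [integral_const_mul, hLap l hl.le]
  have hint : Integrable (Function.uncurry
      (fun (ω : Ω) (l : ℝ) => l ^ (x - 1) * exp (-(l * X ω)))) (μ.prod ν) := by
    have hm : AEStronglyMeasurable (Function.uncurry
      (fun (ω : Ω) (l : ℝ) => l ^ (x - 1) * exp (-(l * X ω)))) (μ.prod ν) := by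
      apply AEMeasurable.aestronglyMeasurable
      have hX' : AEMeasurable (fun p : Ω × ℝ => X p.1) (μ.prod ν) := hXm.comp_fst
      have h2 : AEMeasurable (fun p : Ω × ℝ => p.2) (μ.prod ν) := measurable_snd.aemeasurable
      exact (h2.pow_const _).mul (Real.measurable_exp.comp_aemeasurable (h2.mul hX').neg)
    rw [integrable_prod_iff' hm]
    constructor
    · filter_upwards [hpos] with l hl
      exact (hLapint l hl).const_mul (l ^ (x - 1))
    · have h1 : Integrable (fun l : ℝ => l ^ (x - 1) *
          (1 / (1 + 2 * Real.cos (π * α) * l ^ t + l ^ (2 * t)))) ν := by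
        apply Integrable.of_integral_ne_zero
        rw [hcv]
        positivity
      refine h1.congr ?_
      filter_upwards [hpos] with l hl
      rw [← hin l hl]
      congr 1
      ext ω
      simp only [Function.uncurry_apply_pair]
      rw [Real.norm_of_nonneg (by positivity)]
  have hsw := integral_integral_swap hint
  have hR : ∫ l, ∫ ω, l ^ (x - 1) * exp (-(l * X ω)) ∂μ ∂ν = _ :=
    (integral_congr_ae (hpos.mono fun l hl => hin l hl)).trans hcv
  have hL : ∫ ω, ∫ l, l ^ (x - 1) * exp (-(l * X ω)) ∂ν ∂μ
      = ∫ ω, (X ω) ^ (-x) * Real.Gamma x ∂μ := by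
    apply integral_congr_ae
    filter_upwards [hXpos] with ω hω
    have := Real.integral_rpow_mul_exp_neg_mul_Ioi hx0 hω
    rw [one_div, Real.inv_rpow hω.le, ← Real.rpow_neg hω.le] at this
    rw [← this]
    simp_rw [mul_comm (X ω)]
    rfl
  rw [hL, hR, integral_mul_const] at hsw
  rw [add_comm 1 s, add_comm 1 x, Real.Gamma_add_one hs0.ne', Real.Gamma_add_one hx0.ne']
  have : ∫ ω, (X ω) ^ (-x) ∂μ = (1 / t) * (Real.Gamma s * Real.Gamma (1 - s) *
      (sin (π * α * (1 - s)) / sin (π * α))) / Real.Gamma x := by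
    rw [← hsw]; field_simp
  rw [this]
  have hxe : x = s * t := hst.symm
  generalize Real.Gamma x = G at *
  rw [hxe]
  field_simp
end
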